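/- (Invariant of Theorem 3) Let A ⊆ ℕⁿ be the support of a polynomial p and let M ⊆ ℕⁿ be a finite set. Suppose that for every γ ∈ M with the property that the only pair (α,β) ∈ M×M satisfying α + β = 2γ is (γ,γ), one has 2γ ∈ A. Then the convex hull in ℝⁿ of M is contained in the reduced Newton polytope of p: conv(M) ⊆ (1/2)·C(p). -/

import Mathlib

open scoped Pointwise

/-- The natural embedding of an exponent vector `α ∈ ℕⁿ` as a point of `ℝⁿ`. -/
def expVec {n : ℕ} (α : Fin n →₀ ℕ) : Fin n → ℝ := fun i => (α i : ℝ)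

theorem expVec_injective {n : ℕ} : Function.Injective (expVec : (Fin n →₀ ℕ) → Fin n → ℝ) := by
  intro α β h
  ext i
  exact Nat.cast_injective (congrFun h i)

theorem expVec_add {n : ℕ} (α β : Fin n →₀ ℕ) : expVec (α + β) = expVec α + expVec β := by
  ext i
  simp [expVec]

/-- A polytope is the convex hull of its extreme points. -/
theorem convexHull_extremePoints_of_finite {E : Type*} [AddCommGroup E] [Module ℝ E]
    [TopologicalSpace E] [T2Space E] [IsTopologicalAddGroup E] [ContinuousSMul ℝ E]
    [LocallyConvexSpace ℝ E] {s : Set E} (hs : s.Finite) :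
    convexHull ℝ ((convexHull ℝ s).extremePoints ℝ) = convexHull ℝ s := by
  have hfin : ((convexHull ℝ s).extremePoints ℝ).Finite :=
    hs.subset extremePoints_convexHull_subset
  rw [← (hfin.isClosed_convexHull ℝ).closure_eq]
  exact closure_convexHull_extremePoints (hs.isCompact_convexHull ℝ) (convex_convexHull ℝ s)

/-- An extreme point of `conv(M)` is not the midpoint of two other points of `M`. -/
theorem eq_of_add_eq_of_mem_extremePoints {n : ℕ} {M : Set (Fin n →₀ ℕ)} {α β γ : Fin n →₀ ℕ}
    (hγ : expVec γ ∈ (convexHull ℝ (expVec '' M)).extremePoints ℝ)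
    (hα : α ∈ M) (hβ : β ∈ M) (h : α + β = γ + γ) : α = γ ∧ β = γ := by
  have hsum : expVec α + expVec β = expVec γ + expVec γ := by
    rw [← expVec_add, ← expVec_add, h]
  have hseg : expVec γ ∈ openSegment ℝ (expVec α) (expVec β) :=
    ⟨2⁻¹, 2⁻¹, by norm_num, by norm_num, by norm_num, by
      rw [← smul_add, hsum, smul_add, ← add_smul]; norm_num⟩
  have hα' : α = γ := expVec_injective <|
    hγ.2 (subset_convexHull ℝ _ ⟨α, hα, rfl⟩) (subset_convexHull ℝ _ ⟨β, hβ, rfl⟩) hseg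
  subst hα'
  exact ⟨rfl, add_left_cancel h⟩

/-- **Invariant of Theorem 3.** Let `A` be the support of `p` and `M ⊆ ℕⁿ` a finite set.
If every `γ ∈ M` for which `(γ,γ)` is the only pair in `M × M` summing to `2γ`
satisfies `2γ ∈ A`, then `conv(M) ⊆ (1/2)·C(p)`. -/
theorem convexHull_subset_reduced_newton (n : ℕ) (p : MvPolynomial (Fin n) ℝ)
    (M : Finset (Fin n →₀ ℕ))
    (hM : ∀ γ ∈ M,
      (∀ α ∈ M, ∀ β ∈ M, α + β = γ + γ → α = γ ∧ β = γ) → (γ + γ) ∈ p.support) :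
    convexHull ℝ (expVec '' (M : Set (Fin n →₀ ℕ))) ⊆
      (2⁻¹ : ℝ) • convexHull ℝ (expVec '' (p.support : Set (Fin n →₀ ℕ))) := by
  rw [← convexHull_extremePoints_of_finite (M.finite_toSet.image expVec)]
  refine convexHull_min ?_ ((convex_convexHull ℝ _).smul _)
  intro x hx
  obtain ⟨γ, hγ, rfl⟩ := extremePoints_convexHull_subset hx
  have hmem := hM γ hγ fun α hα β hβ h => eq_of_add_eq_of_mem_extremePoints hx hα hβ h
  refine ⟨expVec (γ + γ), subset_convexHull ℝ _ ⟨γ + γ, hmem, rfl⟩, ?_⟩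
  simp only [expVec_add, smul_add, ← add_smul]
  norm_num
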